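/- Let m ≥ 1 and ν ≥ 1 be integers, p ∈ [1,∞), and fix φ ∈ C^∞(ℝ^m, ℝ) with support in the open unit ball and ∫_{ℝ^m} φ = 1. There exists a constant C ∈ (0,∞), depending only on m, p and φ, such that for every bounded Borel measurable u : ℝ^m → ℝ^ν, every δ ∈ [0,∞) and every x = (x', x_{m+1}) ∈ ℝ^{m+1}_+, the extension by averaging V of u is differentiable at x and ‖DV(x)‖^p ≤ (C / x_{m+1}^p) · (MO_{δ,p}u(x) + δ^p), where ‖DV(x)‖ is the operator norm of the derivative of V at x and MO is the truncated mean oscillation taken with respect to the Euclidean distance of ℝ^ν. -/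

import Mathlib

open MeasureTheory Metric Set
open scoped ENNReal Topology

noncomputable section

abbrev Euc (m : ℕ) : Type := EuclideanSpace ℝ (Fin m)

/-- Truncated mean oscillation `MO_{δ,p} u (x', r)` of a map `u : ℝ^m → N`:
the double average over the ball of radius `r` centered at `x'` of
`(d(u y, u z) - δ)₊ ^ p`. -/
def MO {N : Type} [PseudoMetricSpace N] {m : ℕ} (p δ : ℝ) (u : Euc m → N)
    (x' : Euc m) (r : ℝ) : ℝ≥0∞ :=
  (volume (ball x' r))⁻¹ * (volume (ball x' r))⁻¹ *
    ∫⁻ y in ball x' r, ∫⁻ z in ball x' r,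
      ENNReal.ofReal (max (dist (u y) (u z) - δ) 0 ^ p)

/-- Truncated Gagliardo energy `∬ (d(u y, u z) - δ)₊^p / |y-z|^{2m}`. -/
def truncGagliardo {N : Type} [PseudoMetricSpace N] {m : ℕ} (p δ : ℝ)
    (u : Euc m → N) : ℝ≥0∞ :=
  ∫⁻ y, ∫⁻ z, ENNReal.ofReal (max (dist (u y) (u z) - δ) 0 ^ p) /
    ENNReal.ofReal (dist y z ^ (2 * m))

/-- The cube `r·([0,1]^m + c)` of edge length `r` in `ℝ^m`. -/
def cube (m : ℕ) (r : ℝ) (c : Fin m → ℝ) : Set (Euc m) :=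
  {x | ∀ i, x i ∈ Icc (r * c i) (r * (c i + 1))}


/-- Extension by averaging: `V(x', x_{m+1}) = ∫ u(x' - x_{m+1} z) φ(z) dz`. -/
def avgExt {m ν : ℕ} (φ : Euc m → ℝ) (u : Euc m → Euc ν) (x : Euc m × ℝ) : Euc ν :=
  ∫ z, φ z • u (x.1 - x.2 • z)

open scoped Convolution

/-- The kernel `(s, y) ↦ s^{-m} φ(y / s)` of the extension by averaging. -/
def dilatedKernel {m : ℕ} (φ : Euc m → ℝ) (s : ℝ) (y : Euc m) : ℝ :=
  (s ^ m)⁻¹ * φ (s⁻¹ • y)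

lemma avgExt_eq_convolution {m ν : ℕ} (φ : Euc m → ℝ) (u : Euc m → Euc ν) (x : Euc m) {s : ℝ}
    (hs : 0 < s) :
    avgExt φ u (x, s) =
      (u ⋆[(ContinuousLinearMap.lsmul ℝ ℝ).flip, volume] dilatedKernel φ s) x := by
  rw [convolution_eq_swap]
  have h := Measure.integral_comp_smul volume
    (fun y : Euc m => φ (s⁻¹ • y) • u (x - y)) s
  simp only [inv_smul_smul₀ hs.ne', finrank_euclideanSpace_fin,
    abs_of_pos (inv_pos.2 (pow_pos hs m))] at h
  simp only [avgExt, h, ← integral_smul, dilatedKernel, mul_smul,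
    ContinuousLinearMap.flip_apply, ContinuousLinearMap.lsmul_apply]

lemma contDiffOn_dilatedKernel {m : ℕ} {φ : Euc m → ℝ} (hφ : ContDiff ℝ (⊤ : ℕ∞) φ) :
    ContDiffOn ℝ 1 ↿(dilatedKernel φ) (Ioi (0 : ℝ) ×ˢ (univ : Set (Euc m))) := by
  rintro ⟨s, y⟩ ⟨hs, -⟩
  have hs : s ≠ 0 := ne_of_gt hs
  have hφ1 : ContDiff ℝ 1 φ := hφ.of_le (by exact_mod_cast le_top)
  refine ContDiffAt.contDiffWithinAt ?_
  have h1 : ContDiffAt ℝ 1 (fun q : ℝ × Euc m => (q.1 ^ m)⁻¹) (s, y) :=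
    (contDiffAt_fst.pow m).inv (pow_ne_zero m hs)
  have h2 : ContDiffAt ℝ 1 (fun q : ℝ × Euc m => q.1⁻¹ • q.2) (s, y) :=
    (contDiffAt_fst.inv hs).smul contDiffAt_snd
  exact h1.mul (hφ1.contDiffAt.comp (s, y) h2)

lemma dilatedKernel_eq_smul {m : ℕ} (φ : Euc m → ℝ) {t : ℝ} (ht : 0 < t) :
    ↿(dilatedKernel φ) =
      (t ^ m)⁻¹ • fun q : ℝ × Euc m => ↿(dilatedKernel φ) (t⁻¹ • q) := by
  ext ⟨s, y⟩
  have : (t⁻¹ * s)⁻¹ • t⁻¹ • y = s⁻¹ • y := by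
    rw [smul_smul]
    congr 1
    field_simp
  change (s ^ m)⁻¹ * φ (s⁻¹ • y) =
    (t ^ m)⁻¹ * (((t⁻¹ * s) ^ m)⁻¹ * φ ((t⁻¹ * s)⁻¹ • t⁻¹ • y))
  rw [this, mul_pow, inv_pow, mul_inv, inv_inv, mul_assoc, inv_mul_cancel_left₀ (by positivity)]

lemma fderiv_dilatedKernel {m : ℕ} (φ : Euc m → ℝ) {t : ℝ} (ht : 0 < t) (y : Euc m) :
    fderiv ℝ ↿(dilatedKernel φ) (t, y) =
      ((t ^ m)⁻¹ * t⁻¹) • fderiv ℝ ↿(dilatedKernel φ) (1, t⁻¹ • y) := by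
  conv_lhs => rw [dilatedKernel_eq_smul φ ht]
  rw [fderiv_const_smul_field, Pi.smul_apply, fderiv_comp_smul, smul_smul, Prod.smul_mk,
    smul_eq_mul, inv_mul_cancel₀ ht.ne']

lemma fderiv_dilatedKernel_eq_zero {m : ℕ} {φ : Euc m → ℝ}
    (hφsupp : tsupport φ ⊆ ball (0 : Euc m) 1) {y : Euc m} (hy : y ∉ ball (0 : Euc m) 1) :
    fderiv ℝ ↿(dilatedKernel φ) (1, y) = 0 := by
  have hc : ContinuousAt (fun q : ℝ × Euc m => q.1⁻¹ • q.2) (1, y) :=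
    (continuousAt_fst.inv₀ one_ne_zero).smul continuousAt_snd
  have hn : (tsupport φ)ᶜ ∈ 𝓝 ((1 : ℝ)⁻¹ • y) :=
    (isClosed_tsupport φ).isOpen_compl.mem_nhds (by simpa using fun h => hy (hφsupp h))
  have h0 : ↿(dilatedKernel φ) =ᶠ[𝓝 ((1 : ℝ), y)] fun _ => (0 : ℝ) := by
    filter_upwards [hc hn] with q hq
    change (q.1 ^ m)⁻¹ * φ (q.1⁻¹ • q.2) = 0
    rw [image_eq_zero_of_notMem_tsupport hq, mul_zero]
  rw [h0.fderiv_eq]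
  simp

lemma exists_norm_fderiv_dilatedKernel_le {m : ℕ} {φ : Euc m → ℝ}
    (hφ : ContDiff ℝ (⊤ : ℕ∞) φ) (hφsupp : tsupport φ ⊆ ball (0 : Euc m) 1) :
    ∃ c : ℝ, 0 < c ∧ ∀ t : ℝ, 0 < t → ∀ y : Euc m,
      ‖fderiv ℝ ↿(dilatedKernel φ) (t, y)‖ ≤
        (ball (0 : Euc m) t).indicator (fun _ => c * ((t ^ m)⁻¹ * t⁻¹)) y := by
  have hcont : Continuous fun y : Euc m => fderiv ℝ ↿(dilatedKernel φ) (1, y) :=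
    ((contDiffOn_dilatedKernel hφ).continuousOn_fderiv_of_isOpen
      (isOpen_Ioi.prod isOpen_univ) le_rfl).comp_continuous (by fun_prop) (by simp)
  obtain ⟨c, hc⟩ := (isCompact_closedBall (0 : Euc m) 1).exists_bound_of_continuousOn
    hcont.continuousOn
  refine ⟨max c 1, by positivity, fun t ht y => ?_⟩
  have hpos : 0 ≤ (t ^ m)⁻¹ * t⁻¹ := by positivity
  have hmem : t⁻¹ • y ∈ ball (0 : Euc m) 1 ↔ y ∈ ball (0 : Euc m) t := by
    simp only [mem_ball_zero_iff, norm_smul, norm_inv, Real.norm_of_nonneg ht.le]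
    rw [inv_mul_lt_iff₀ ht, mul_one]
  rw [fderiv_dilatedKernel φ ht y]
  by_cases hy : y ∈ ball (0 : Euc m) t
  · rw [indicator_of_mem hy, norm_smul, Real.norm_of_nonneg hpos, mul_comm]
    gcongr
    exact (hc _ (ball_subset_closedBall (hmem.2 hy))).trans (le_max_left _ _)
  · rw [indicator_of_notMem hy, fderiv_dilatedKernel_eq_zero hφsupp (mt hmem.1 hy)]
    simp

lemma integrable_of_measurable_of_bounded {m ν : ℕ} {u : Euc m → Euc ν} (hu : Measurable u)
    {M : ℝ} (hM : ∀ x, ‖u x‖ ≤ M) (μ : Measure (Euc m)) [IsFiniteMeasure μ] :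
    Integrable u μ :=
  .of_bound hu.aestronglyMeasurable M (.of_forall hM)

lemma exists_norm_fderiv_avgExt_le {m : ℕ} {φ : Euc m → ℝ}
    (hφ : ContDiff ℝ (⊤ : ℕ∞) φ) (hφsupp : tsupport φ ⊆ ball (0 : Euc m) 1) :
    ∃ c : ℝ, 0 < c ∧ ∀ (ν : ℕ) (u : Euc m → Euc ν), Measurable u →
      (∃ M : ℝ, ∀ x, ‖u x‖ ≤ M) → ∀ (x : Euc m) (t : ℝ), 0 < t →
      DifferentiableAt ℝ (avgExt φ u) (x, t) ∧
      ‖fderiv ℝ (avgExt φ u) (x, t)‖ ≤ c * t⁻¹ * ⨍ y in ball x t, ‖u y‖ := by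
  obtain ⟨c, hc, hK⟩ := exists_norm_fderiv_dilatedKernel_le hφ hφsupp
  have hω : 0 < volume.real (ball (0 : Euc m) 1) :=
    ENNReal.toReal_pos (measure_ball_pos _ _ one_pos).ne' measure_ball_lt_top.ne
  refine ⟨c * volume.real (ball (0 : Euc m) 1), by positivity, fun ν u hu ⟨M, hM⟩ x t ht => ?_⟩
  have hloc : LocallyIntegrable u volume := by
    rw [locallyIntegrable_iff]
    intro k hk
    have : IsFiniteMeasure (volume.restrict k) := ⟨by simpa using hk.measure_lt_top⟩
    exact integrable_of_measurable_of_bounded hu hM _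
  set L : Euc ν →L[ℝ] ℝ →L[ℝ] Euc ν := (ContinuousLinearMap.lsmul ℝ ℝ).flip
  have hLnorm : ∀ (v : Euc ν) (T : ℝ × Euc m →L[ℝ] ℝ),
      ‖L.precompR (ℝ × Euc m) v T‖ ≤ ‖v‖ * ‖T‖ := fun v T =>
    ContinuousLinearMap.opNorm_le_bound _ (by positivity) fun q => by
      change ‖T q • v‖ ≤ _
      rw [norm_smul, mul_assoc, mul_comm]
      gcongr
      exact T.le_opNorm q
  have hvanish : ∀ s : ℝ, ∀ y : Euc m, s ∈ Ioo 0 (2 * t) → y ∉ closedBall (0 : Euc m) (2 * t) →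
      dilatedKernel φ s y = 0 := by
    intro s y hs hy
    have : s⁻¹ • y ∉ tsupport φ := fun h => by
      have := hφsupp h
      simp only [mem_ball_zero_iff, norm_smul, norm_inv, Real.norm_of_nonneg hs.1.le] at this
      rw [inv_mul_lt_iff₀ hs.1] at this
      simp only [mem_closedBall_zero_iff, not_le] at hy
      linarith [hs.2]
    rw [dilatedKernel, image_eq_zero_of_notMem_tsupport this, mul_zero]
  have hconv := hasFDerivAt_convolution_right_with_param L (μ := volume) isOpen_Ioo
    (isCompact_closedBall (0 : Euc m) (2 * t)) hvanish hloc
    ((contDiffOn_dilatedKernel hφ).mono (prod_mono Ioo_subset_Ioi_self subset_rfl)) (t, x)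
    ⟨ht, by linarith⟩
  set D := (u ⋆[L.precompR (ℝ × Euc m), volume]
    fun y : Euc m => fderiv ℝ ↿(dilatedKernel φ) (t, y)) x
  set S := ContinuousLinearMap.prod (ContinuousLinearMap.snd ℝ (Euc m) ℝ)
    (ContinuousLinearMap.fst ℝ (Euc m) ℝ) with hS
  have hSnorm : ‖S‖ ≤ 1 := ContinuousLinearMap.opNorm_le_bound _ zero_le_one fun q => by
    simp [hS, Prod.norm_def, max_comm]
  have hder : HasFDerivAt (avgExt φ u) (D.comp S) (x, t) := by
    refine (hconv.comp (x, t) S.hasFDerivAt (f := S)).congr_of_eventuallyEq ?_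
    have : ∀ᶠ q : Euc m × ℝ in 𝓝 (x, t), 0 < q.2 :=
      continuousAt_snd.eventually (lt_mem_nhds ht)
    filter_upwards [this] with q hq
    exact avgExt_eq_convolution φ u q.1 hq
  refine ⟨hder.differentiableAt, ?_⟩
  have hint : ∀ y, ‖L.precompR (ℝ × Euc m) (u y) (fderiv ℝ ↿(dilatedKernel φ) (t, x - y))‖ ≤
      (ball x t).indicator (fun y => c * ((t ^ m)⁻¹ * t⁻¹) * ‖u y‖) y := by
    intro y
    have hxy : x - y ∈ ball (0 : Euc m) t ↔ y ∈ ball x t := by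
      rw [mem_ball_zero_iff, mem_ball, dist_comm, dist_eq_norm]
    have h2 := hK t ht (x - y)
    refine (hLnorm _ _).trans ?_
    by_cases hy : y ∈ ball x t
    · rw [indicator_of_mem (hxy.2 hy)] at h2
      rw [indicator_of_mem hy, mul_comm]
      gcongr
    · rw [indicator_of_notMem (mt hxy.1 hy)] at h2
      rw [indicator_of_notMem hy]
      exact mul_nonpos_of_nonneg_of_nonpos (norm_nonneg _) h2
  have hfin : IsFiniteMeasure (volume.restrict (ball x t)) := ⟨by simpa using measure_ball_lt_top⟩
  have hvol : volume.real (ball x t) = t ^ m * volume.real (ball (0 : Euc m) 1) := by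
    rw [measureReal_def, Measure.addHaar_ball_of_pos _ _ ht, ENNReal.toReal_mul,
      ENNReal.toReal_ofReal (by positivity), finrank_euclideanSpace_fin, measureReal_def]
  rw [hder.fderiv]
  calc ‖D.comp S‖ ≤ ‖D‖ * ‖S‖ := ContinuousLinearMap.opNorm_comp_le _ _
    _ ≤ ‖D‖ := mul_le_of_le_one_right (norm_nonneg _) hSnorm
    _ ≤ ∫ y, (ball x t).indicator (fun y => c * ((t ^ m)⁻¹ * t⁻¹) * ‖u y‖) y := by
        refine norm_integral_le_of_norm_le ?_ (.of_forall hint)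
        rw [integrable_indicator_iff measurableSet_ball]
        exact ((integrable_of_measurable_of_bounded hu hM _).norm.const_mul _)
    _ = c * ((t ^ m)⁻¹ * t⁻¹) * ∫ y in ball x t, ‖u y‖ := by
        rw [integral_indicator measurableSet_ball, integral_const_mul]
    _ = c * volume.real (ball (0 : Euc m) 1) * t⁻¹ * ⨍ y in ball x t, ‖u y‖ := by
        rw [setAverage_eq, hvol, smul_eq_mul]
        field_simp

lemma avgExt_sub_const {m ν : ℕ} {φ : Euc m → ℝ} (hφ : ContDiff ℝ (⊤ : ℕ∞) φ)
    (hφsupp : tsupport φ ⊆ ball (0 : Euc m) 1) (hφint : ∫ z, φ z = 1) {u : Euc m → Euc ν}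
    (hu : Measurable u) {M : ℝ} (hM : ∀ x, ‖u x‖ ≤ M) (a : Euc ν) :
    avgExt φ (fun y => u y - a) = fun q => avgExt φ u q - a := by
  have hφi : Integrable φ :=
    hφ.continuous.integrable_of_hasCompactSupport <|
      (isCompact_closedBall (0 : Euc m) 1).of_isClosed_subset (isClosed_tsupport φ)
        (hφsupp.trans ball_subset_closedBall)
  ext1 q
  have h1 : Integrable fun z => φ z • u (q.1 - q.2 • z) :=
    hφi.smul_bdd M (hu.comp (by fun_prop)).aestronglyMeasurable (.of_forall fun z => hM _)
  simp only [avgExt, smul_sub]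
  rw [integral_sub h1 (hφi.smul_const a), integral_smul_const, hφint, one_smul]

lemma rpow_setAverage_le {m : ℕ} {p δ M : ℝ} (hp : 1 ≤ p) (hδ : 0 ≤ δ) {d : Euc m → ℝ}
    (hd : Measurable d) (hd0 : ∀ y, 0 ≤ d y) (hdM : ∀ y, d y ≤ M) (x : Euc m) {t : ℝ}
    (ht : 0 < t) :
    ENNReal.ofReal ((⨍ y in ball x t, d y) ^ p) ≤
      ENNReal.ofReal (2 ^ (p - 1)) * (ENNReal.ofReal (δ ^ p) + (volume (ball x t))⁻¹ *
        ∫⁻ y in ball x t, ENNReal.ofReal (max (d y - δ) 0 ^ p)) := by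
  have hp0 : 0 ≤ p := zero_le_one.trans hp
  have hfin : IsFiniteMeasure (volume.restrict (ball x t)) := ⟨by simpa using measure_ball_lt_top⟩
  have hb0 : volume (ball x t) ≠ 0 := (measure_ball_pos _ _ ht).ne'
  have hbt : volume (ball x t) ≠ ∞ := measure_ball_lt_top.ne
  have hdp : IntegrableOn (fun y => d y ^ p) (ball x t) :=
    .of_bound hbt.lt_top (hd.pow_const p).aestronglyMeasurable (M ^ p) <| .of_forall fun y => by
      rw [Real.norm_of_nonneg (Real.rpow_nonneg (hd0 y) p)]
      exact Real.rpow_le_rpow (hd0 y) (hdM y) hp0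
  have hjensen : (⨍ y in ball x t, d y) ^ p ≤ ⨍ y in ball x t, d y ^ p :=
    (convexOn_rpow hp).map_set_average_le
      (Real.continuous_rpow_const hp0).continuousOn isClosed_Ici hb0 hbt (.of_forall hd0)
      (.of_bound hbt.lt_top hd.aestronglyMeasurable M <| .of_forall fun y => by
        rw [Real.norm_of_nonneg (hd0 y)]; exact hdM y) hdp
  have hpt : ∀ y, ENNReal.ofReal (d y ^ p) ≤ ENNReal.ofReal (2 ^ (p - 1)) *
      (ENNReal.ofReal (δ ^ p) + ENNReal.ofReal (max (d y - δ) 0 ^ p)) := by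
    intro y
    have h := ENNReal.rpow_add_le_mul_rpow_add_rpow (ENNReal.ofReal δ)
      (ENNReal.ofReal (max (d y - δ) 0)) hp
    rw [ENNReal.ofReal_rpow_of_nonneg hδ hp0,
      ENNReal.ofReal_rpow_of_nonneg (le_max_right _ _) hp0,
      ← ENNReal.ofReal_add hδ (le_max_right _ _),
      ENNReal.ofReal_rpow_of_nonneg (add_nonneg hδ (le_max_right _ _)) hp0] at h
    rw [← ENNReal.ofReal_rpow_of_pos two_pos, ENNReal.ofReal_ofNat]
    refine (ENNReal.ofReal_le_ofReal (Real.rpow_le_rpow (hd0 y) ?_ hp0)).trans h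
    linarith [le_max_left (d y - δ) 0]
  calc ENNReal.ofReal ((⨍ y in ball x t, d y) ^ p)
      ≤ ENNReal.ofReal (⨍ y in ball x t, d y ^ p) := ENNReal.ofReal_le_ofReal hjensen
    _ = (volume (ball x t))⁻¹ * ∫⁻ y in ball x t, ENNReal.ofReal (d y ^ p) := by
        rw [ofReal_setAverage hdp (.of_forall fun y => Real.rpow_nonneg (hd0 y) p),
          ENNReal.div_eq_inv_mul]
    _ ≤ (volume (ball x t))⁻¹ * ∫⁻ y in ball x t, ENNReal.ofReal (2 ^ (p - 1)) *
          (ENNReal.ofReal (δ ^ p) + ENNReal.ofReal (max (d y - δ) 0 ^ p)) := by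
        gcongr with y
        exact hpt y
    _ = _ := by
        rw [lintegral_const_mul' _ _ ENNReal.ofReal_ne_top, lintegral_add_left measurable_const,
          setLIntegral_const, mul_left_comm, mul_add, mul_left_comm,
          ENNReal.inv_mul_cancel hb0 hbt, mul_one]

/-- Estimate (2.6): gradient bound for the averaged extension,
`‖DV(x)‖^p ≤ (C / x_{m+1}^p) (MO_{δ,p}u(x) + δ^p)`. -/
theorem fderiv_avgExt_le (m : ℕ) (hm : 1 ≤ m) (p : ℝ) (hp : 1 ≤ p)
    (φ : Euc m → ℝ) (hφ : ContDiff ℝ (⊤ : ℕ∞) φ)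
    (hφsupp : tsupport φ ⊆ ball (0 : Euc m) 1) (hφint : ∫ z, φ z = 1) :
    ∃ C : ℝ, 0 < C ∧
      ∀ (ν : ℕ), 1 ≤ ν →
      ∀ (u : Euc m → Euc ν), Measurable u → (∃ M : ℝ, ∀ x, ‖u x‖ ≤ M) →
      ∀ (δ : ℝ), 0 ≤ δ →
      ∀ (x' : Euc m) (t : ℝ), 0 < t →
      DifferentiableAt ℝ (avgExt φ u) (x', t) ∧
      ENNReal.ofReal (‖fderiv ℝ (avgExt φ u) (x', t)‖ ^ p)
        ≤ ENNReal.ofReal (C / t ^ p) * (MO p δ u x' t + ENNReal.ofReal (δ ^ p)) := by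
  obtain ⟨c, hc, hder⟩ := exists_norm_fderiv_avgExt_le hφ hφsupp
  refine ⟨c ^ p * 2 ^ (p - 1), by positivity, fun ν _ u hu ⟨M, hM⟩ δ hδ x t ht =>
    ⟨(hder ν u hu ⟨M, hM⟩ x t ht).1, ?_⟩⟩
  have hp0 : 0 ≤ p := zero_le_one.trans hp
  have hb0 : volume (ball x t) ≠ 0 := (measure_ball_pos _ _ ht).ne'
  have hbt : volume (ball x t) ≠ ∞ := measure_ball_lt_top.ne
  set A := ENNReal.ofReal (c ^ p * 2 ^ (p - 1) / t ^ p) with hA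
  set b := volume (ball x t)
  set N := ‖fderiv ℝ (avgExt φ u) (x, t)‖ with hN
  have hpoint : ∀ y, ENNReal.ofReal (N ^ p) ≤ A * (ENNReal.ofReal (δ ^ p) +
      b⁻¹ * ∫⁻ z in ball x t, ENNReal.ofReal (max (dist (u y) (u z) - δ) 0 ^ p)) := by
    intro y
    have hM' : ∀ z, ‖u z - u y‖ ≤ M + M := fun z =>
      (norm_sub_le _ _).trans (add_le_add (hM z) (hM y))
    have h1 := (hder ν (fun z => u z - u y) (hu.sub_const _) ⟨_, hM'⟩ x t ht).2
    rw [avgExt_sub_const hφ hφsupp hφint hu hM, fderiv_sub_const, ← hN] at h1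
    have h2 := rpow_setAverage_le hp hδ (hu.sub_const (u y)).norm (fun z => norm_nonneg _) hM' x ht
    have h0 : 0 ≤ ⨍ z in ball x t, ‖u z - u y‖ := by
      rw [setAverage_eq]
      positivity
    have hA' : A = ENNReal.ofReal ((c * t⁻¹) ^ p) * ENNReal.ofReal (2 ^ (p - 1)) := by
      rw [hA, ← ENNReal.ofReal_mul (by positivity), Real.mul_rpow hc.le (by positivity),
        Real.inv_rpow ht.le]
      congr 1
      ring
    simp only [dist_comm (u y), dist_eq_norm]
    calc ENNReal.ofReal (N ^ p)
        ≤ ENNReal.ofReal ((c * t⁻¹ * ⨍ z in ball x t, ‖u z - u y‖) ^ p) :=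
          ENNReal.ofReal_le_ofReal (Real.rpow_le_rpow (norm_nonneg _) h1 hp0)
      _ = ENNReal.ofReal ((c * t⁻¹) ^ p) *
            ENNReal.ofReal ((⨍ z in ball x t, ‖u z - u y‖) ^ p) := by
          rw [Real.mul_rpow (by positivity) h0, ENNReal.ofReal_mul (by positivity)]
      _ ≤ _ := by
          rw [hA', mul_assoc]
          gcongr
  calc ENNReal.ofReal (N ^ p)
      = b⁻¹ * ∫⁻ _ in ball x t, ENNReal.ofReal (N ^ p) := by
        rw [setLIntegral_const, mul_left_comm, ENNReal.inv_mul_cancel hb0 hbt, mul_one]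
    _ ≤ b⁻¹ * ∫⁻ y in ball x t, A * (ENNReal.ofReal (δ ^ p) +
          b⁻¹ * ∫⁻ z in ball x t, ENNReal.ofReal (max (dist (u y) (u z) - δ) 0 ^ p)) := by
        gcongr with y
        exact hpoint y
    _ = _ := by
        rw [lintegral_const_mul' _ _ ENNReal.ofReal_ne_top, lintegral_add_left measurable_const,
          setLIntegral_const, lintegral_const_mul' _ _ (ENNReal.inv_ne_top.2 hb0),
          mul_left_comm, mul_add, mul_left_comm, ENNReal.inv_mul_cancel hb0 hbt, mul_one, MO,
          add_comm, mul_assoc b⁻¹]
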